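/- arXiv:1712.00833 — 3 statements merged into one kernel-verified Lean document; each statement's English description precedes it below -/
import Mathlib

section
/- Let Q be a 2×2 complex Hermitian matrix with det Q > 0 and trace Q > 0 (the spinor image of a massive positive-energy momentum). Then the stability subgroup G_Q = {A ∈ SL(2,ℂ) : A · Q · A† = Q} of Q inside the special linear group SL(2,ℂ) is isomorphic, as a group, to the special unitary group SU(2). -/
noncomputable section

open Matrix

/-- The stability subgroup `G_Q = {A ∈ SL(2,ℂ) : A Q A† = Q}` of a Hermitian matrix `Q`
inside `SL(2,ℂ)`. -/
def stabGroup (Q : Matrix (Fin 2) (Fin 2) ℂ) :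
    Subgroup (Matrix.SpecialLinearGroup (Fin 2) ℂ) where
  carrier := {A | (A : Matrix (Fin 2) (Fin 2) ℂ) * Q * (A : Matrix (Fin 2) (Fin 2) ℂ)ᴴ = Q}
  one_mem' := by simp
  mul_mem' := by
    intro a b ha hb
    simp only [Set.mem_setOf_eq] at ha hb ⊢
    have hab : ((a * b : Matrix.SpecialLinearGroup (Fin 2) ℂ) : Matrix (Fin 2) (Fin 2) ℂ)
        = (a : Matrix (Fin 2) (Fin 2) ℂ) * (b : Matrix (Fin 2) (Fin 2) ℂ) := rfl
    rw [hab, conjTranspose_mul]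
    calc (a : Matrix (Fin 2) (Fin 2) ℂ) * (b : Matrix (Fin 2) (Fin 2) ℂ) * Q *
          ((b : Matrix (Fin 2) (Fin 2) ℂ)ᴴ * (a : Matrix (Fin 2) (Fin 2) ℂ)ᴴ)
        = (a : Matrix (Fin 2) (Fin 2) ℂ) *
            ((b : Matrix (Fin 2) (Fin 2) ℂ) * Q * (b : Matrix (Fin 2) (Fin 2) ℂ)ᴴ) *
            (a : Matrix (Fin 2) (Fin 2) ℂ)ᴴ := by
          simp only [Matrix.mul_assoc]
      _ = Q := by rw [hb, ha]
  inv_mem' := by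
    intro a ha
    simp only [Set.mem_setOf_eq] at ha ⊢
    have h1 : ((a⁻¹ : Matrix.SpecialLinearGroup (Fin 2) ℂ) : Matrix (Fin 2) (Fin 2) ℂ) *
        (a : Matrix (Fin 2) (Fin 2) ℂ) = 1 := by
      rw [← Matrix.SpecialLinearGroup.coe_mul, inv_mul_cancel a,
        Matrix.SpecialLinearGroup.coe_one]
    have h3 : (a : Matrix (Fin 2) (Fin 2) ℂ)ᴴ *
        ((a⁻¹ : Matrix.SpecialLinearGroup (Fin 2) ℂ) : Matrix (Fin 2) (Fin 2) ℂ)ᴴ = 1 := by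
      have h := congrArg Matrix.conjTranspose h1
      rw [Matrix.conjTranspose_mul, Matrix.conjTranspose_one] at h
      exact h
    calc ((a⁻¹ : Matrix.SpecialLinearGroup (Fin 2) ℂ) : Matrix (Fin 2) (Fin 2) ℂ) * Q *
          ((a⁻¹ : Matrix.SpecialLinearGroup (Fin 2) ℂ) : Matrix (Fin 2) (Fin 2) ℂ)ᴴ
        = ((a⁻¹ : Matrix.SpecialLinearGroup (Fin 2) ℂ) : Matrix (Fin 2) (Fin 2) ℂ) *
            ((a : Matrix (Fin 2) (Fin 2) ℂ) * Q * (a : Matrix (Fin 2) (Fin 2) ℂ)ᴴ) *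
            ((a⁻¹ : Matrix.SpecialLinearGroup (Fin 2) ℂ) : Matrix (Fin 2) (Fin 2) ℂ)ᴴ := by
          rw [ha]
      _ = (((a⁻¹ : Matrix.SpecialLinearGroup (Fin 2) ℂ) : Matrix (Fin 2) (Fin 2) ℂ) *
            (a : Matrix (Fin 2) (Fin 2) ℂ)) * Q *
            ((a : Matrix (Fin 2) (Fin 2) ℂ)ᴴ *
              ((a⁻¹ : Matrix.SpecialLinearGroup (Fin 2) ℂ) : Matrix (Fin 2) (Fin 2) ℂ)ᴴ) := by
          simp only [Matrix.mul_assoc]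
      _ = Q := by rw [h1, h3, Matrix.one_mul, Matrix.mul_one]

open ComplexOrder in
/-- A `2 × 2` Hermitian matrix with positive determinant and positive trace is positive definite. -/
lemma posDef_of_det_pos_of_trace_pos {Q : Matrix (Fin 2) (Fin 2) ℂ} (hQ : Q.IsHermitian)
    {d t : ℝ} (hd : 0 < d) (hdet : Q.det = (d : ℂ)) (ht : 0 < t) (htr : Q.trace = (t : ℂ)) :
    Q.PosDef := by
  have hprod : hQ.eigenvalues 0 * hQ.eigenvalues 1 = d := by
    have h := hQ.det_eq_prod_eigenvalues
    rw [hdet, Fin.prod_univ_two] at h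
    simpa using (congrArg Complex.re h).symm
  have hsum : hQ.eigenvalues 0 + hQ.eigenvalues 1 = t := by
    have h := hQ.trace_eq_sum_eigenvalues
    rw [htr, Fin.sum_univ_two] at h
    simpa using (congrArg Complex.re h).symm
  rw [hQ.posDef_iff_eigenvalues_pos, Fin.forall_fin_two]
  constructor <;> by_contra! hneg <;> nlinarith

open ComplexOrder MatrixOrder in
/-- A positive definite matrix factors as `P * Pᴴ` with `P` invertible. -/
lemma Matrix.PosDef.exists_eq_mul_conjTranspose {n : Type*} [Fintype n] [DecidableEq n]
    {Q : Matrix n n ℂ} (hQ : Q.PosDef) : ∃ P : Matrix n n ℂ, IsUnit P.det ∧ Q = P * Pᴴ := by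
  obtain ⟨B, rfl⟩ := CStarAlgebra.nonneg_iff_eq_star_mul_self.1 hQ.posSemidef.nonneg
  have hdet := (isUnit_iff_isUnit_det _).1 hQ.isUnit
  rw [det_mul] at hdet
  exact ⟨Bᴴ, isUnit_of_mul_isUnit_left hdet, by rw [conjTranspose_conjTranspose]; rfl⟩

/-- Conjugation by `P` identifies the stability subgroup of `P * Pᴴ` with `SU(2)`. -/
def stabGroupMulConjTransposeEquiv (P : Matrix (Fin 2) (Fin 2) ℂ) (hP : IsUnit P.det) :
    stabGroup (P * Pᴴ) ≃* Matrix.specialUnitaryGroup (Fin 2) ℂ where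
  toFun A := ⟨P⁻¹ * A.1.1 * P, by
    have hA : A.1.1 * (P * Pᴴ) * A.1.1ᴴ = P * Pᴴ := A.2
    have hPH : IsUnit Pᴴ.det := by simpa [det_conjTranspose] using hP
    refine mem_specialUnitaryGroup_iff.2 ⟨mem_unitaryGroup_iff.2 ?_, ?_⟩
    · calc P⁻¹ * A.1.1 * P * (P⁻¹ * A.1.1 * P)ᴴ
          = P⁻¹ * (A.1.1 * (P * Pᴴ) * A.1.1ᴴ) * (Pᴴ)⁻¹ := by
            simp only [conjTranspose_mul, conjTranspose_nonsing_inv, Matrix.mul_assoc]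
        _ = 1 := by
            rw [hA, nonsing_inv_mul_cancel_left _ _ hP, mul_nonsing_inv _ hPH]
    · rw [det_conj' ((isUnit_iff_isUnit_det P).2 hP), A.1.2]⟩
  invFun U := ⟨⟨P * U.1 * P⁻¹, by
      rw [det_conj ((isUnit_iff_isUnit_det P).2 hP), (mem_specialUnitaryGroup_iff.1 U.2).2]⟩, by
    have hU : U.1 * U.1ᴴ = 1 := mem_unitaryGroup_iff.1 (mem_specialUnitaryGroup_iff.1 U.2).1
    have hPH : IsUnit Pᴴ.det := by simpa [det_conjTranspose] using hP
    calc P * U.1 * P⁻¹ * (P * Pᴴ) * (P * U.1 * P⁻¹)ᴴ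
        = P * (U.1 * ((P⁻¹ * P) * ((Pᴴ * (Pᴴ)⁻¹) * U.1ᴴ))) * Pᴴ := by
          simp only [conjTranspose_mul, conjTranspose_nonsing_inv, Matrix.mul_assoc]
      _ = P * Pᴴ := by
          rw [nonsing_inv_mul _ hP, mul_nonsing_inv _ hPH, Matrix.one_mul, Matrix.one_mul, hU,
            Matrix.mul_one]⟩
  left_inv A := by
    apply Subtype.ext
    apply Subtype.ext
    simp [Matrix.mul_assoc, hP.ne_zero]
  right_inv U := by
    apply Subtype.ext
    simp [Matrix.mul_assoc, hP.ne_zero]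
  map_mul' A B := by
    apply Subtype.ext
    simp [Matrix.mul_assoc, hP.ne_zero]

/-- The stability subgroup of a positive-definite Hermitian momentum matrix `Q`
(spinor image of a massive positive-energy momentum: `det Q > 0`, `tr Q > 0`)
inside `SL(2,ℂ)` is isomorphic, as a group, to `SU(2)`. -/
theorem stability_subgroup_iso_SU2
    (Q : Matrix (Fin 2) (Fin 2) ℂ) (hherm : Q.IsHermitian)
    (hdet : ∃ d : ℝ, 0 < d ∧ Q.det = (d : ℂ))
    (htr : ∃ t : ℝ, 0 < t ∧ Q.trace = (t : ℂ)) :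
    Nonempty (stabGroup Q ≃* Matrix.specialUnitaryGroup (Fin 2) ℂ) := by
  obtain ⟨d, hd, hdet⟩ := hdet
  obtain ⟨t, ht, htr⟩ := htr
  obtain ⟨P, hP, rfl⟩ :=
    (posDef_of_det_pos_of_trace_pos hherm hd hdet ht htr).exists_eq_mul_conjTranspose
  exact ⟨stabGroupMulConjTransposeEquiv P hP⟩
end
end

section
/- Let k ∈ ℝ⁴, let m ∈ ℝ with m ≠ 0, and let h be a complex symmetric 4×4 array, h_{mn} = h_{nm}. Write h = Σ η^{rs} h_{rs} for its trace and k² = Σ η^{rs}k_r k_s. Then the Pauli–Fierz equation k² h_{mn} − k_m Σ_r k^r h_{rn} − k_n Σ_r k^r h_{rm} + η_{mn} Σ_{r,ℓ} k^r k^ℓ h_{rℓ} + k_n k_m h − η_{mn} k² h − m²(h_{mn} − η_{mn} h) = 0 holds for all m, n if and only if the three conditions hold: Σ_{m,n} η^{mn} h_{mn} = 0; Σ_m k^m h_{mn} = 0 for all n; and (k² − m²)·h_{mn} = 0 for all m, n. -/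
noncomputable section

/-- The Minkowski metric `η = diag(1,−1,−1,−1)` (identical upper/lower components). -/
def eta4 : Fin 4 → Fin 4 → ℝ := fun m n => if m = n then (if m = 0 then 1 else -1) else 0

/-- Raised components `k^n = η^{nm} k_m` of a four-vector. -/
def raise (k : Fin 4 → ℝ) : Fin 4 → ℝ := fun n => ∑ m : Fin 4, eta4 n m * k m

/-- The double contraction of a vector with an array vanishes if the first contraction does. -/
theorem sum_sum_mul_eq_zero {ι R : Type*} [Fintype ι] [CommSemiring R] {v : ι → R}
    {h : ι → ι → R} (hv : ∀ l, ∑ r, v r * h r l = 0) :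
    ∑ r, ∑ l, v r * v l * h r l = 0 := by
  rw [Finset.sum_comm]
  refine Finset.sum_eq_zero fun l _ => ?_
  calc
    ∑ r, v r * v l * h r l = (∑ r, v r * h r l) * v l := by
      simp only [Finset.sum_mul, mul_right_comm _ (h _ _) (v l)]
    _ = 0 := by rw [hv, zero_mul]

/-- The massive Pauli–Fierz equation for a symmetric tensor field `h_{mn}` is equivalent to
tracelessness `η^{mn}h_{mn} = 0`, transversality `kᵐ h_{mn} = 0`, and the mass-shell condition
`(k² − m²) h_{mn} = 0`. -/
theorem pauli_fierz_equiv (k : Fin 4 → ℝ) (M : ℝ) (hM : M ≠ 0)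
    (h : Fin 4 → Fin 4 → ℂ) (hsym : ∀ m n : Fin 4, h m n = h n m) :
    (∀ m n : Fin 4,
        ((∑ p : Fin 4, raise k p * k p : ℝ) : ℂ) * h m n -
          (k m : ℂ) * (∑ r : Fin 4, (raise k r : ℂ) * h r n) -
          (k n : ℂ) * (∑ r : Fin 4, (raise k r : ℂ) * h r m) +
          (eta4 m n : ℂ) * (∑ r : Fin 4, ∑ l : Fin 4, (raise k r : ℂ) * (raise k l : ℂ) * h r l) +
          (k n : ℂ) * (k m : ℂ) * (∑ r : Fin 4, ∑ s : Fin 4, (eta4 r s : ℂ) * h r s) -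
          (eta4 m n : ℂ) * ((∑ p : Fin 4, raise k p * k p : ℝ) : ℂ) *
            (∑ r : Fin 4, ∑ s : Fin 4, (eta4 r s : ℂ) * h r s) -
          ((M : ℂ)) ^ 2 *
            (h m n - (eta4 m n : ℂ) * (∑ r : Fin 4, ∑ s : Fin 4, (eta4 r s : ℂ) * h r s)) = 0) ↔
      ((∑ m : Fin 4, ∑ n : Fin 4, (eta4 m n : ℂ) * h m n = 0) ∧
        (∀ n : Fin 4, ∑ m : Fin 4, (raise k m : ℂ) * h m n = 0) ∧
        ∀ m n : Fin 4, (((∑ p : Fin 4, raise k p * k p) - M ^ 2 : ℝ) : ℂ) * h m n = 0) := by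
  have raise_zero : raise k 0 = k 0 := by simp [raise, eta4]
  have raise_one : raise k 1 = -k 1 := by simp [raise, eta4]
  have raise_two : raise k 2 = -k 2 := by simp [raise, eta4]
  have raise_three : raise k 3 = -k 3 := by simp [raise, eta4]
  have hMC : (M : ℂ) ^ 2 ≠ 0 := pow_ne_zero 2 (Complex.ofReal_ne_zero.mpr hM)
  constructor
  · intro E
    have trace_eq : ∑ m : Fin 4, ∑ n : Fin 4, (eta4 m n : ℂ) * h m n =
        h 0 0 - h 1 1 - h 2 2 - h 3 3 := by
      simp [Fin.sum_univ_four, eta4]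
      ring
    -- The divergence of the equation leaves only its mass term.
    have div_eq : ∀ n : Fin 4, ∑ m : Fin 4, (raise k m : ℂ) * h m n =
        (k n : ℂ) * ∑ r : Fin 4, ∑ s : Fin 4, (eta4 r s : ℂ) * h r s := by
      intro n
      refine mul_left_cancel₀ hMC ?_
      have E0 := E 0 n
      have E1 := E 1 n
      have E2 := E 2 n
      have E3 := E 3 n
      rw [trace_eq] at E0 E1 E2 E3 ⊢
      fin_cases n <;>
      · simp [-mul_eq_mul_left_iff, Fin.sum_univ_four, eta4,
          raise_zero, raise_one, raise_two, raise_three,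
          hsym 1 0, hsym 2 0, hsym 3 0, hsym 2 1, hsym 3 1, hsym 3 2] at E0 E1 E2 E3 ⊢
        linear_combination
          -(k 0 : ℂ) * E0 + (k 1 : ℂ) * E1 + (k 2 : ℂ) * E2 + (k 3 : ℂ) * E3
    have trace_zero : ∑ m : Fin 4, ∑ n : Fin 4, (eta4 m n : ℂ) * h m n = 0 := by
      have D0 := div_eq 0
      have D1 := div_eq 1
      have D2 := div_eq 2
      have D3 := div_eq 3
      have E0 := E 0 0
      have E1 := E 1 1
      have E2 := E 2 2
      have E3 := E 3 3
      refine (mul_eq_zero.mp ?_).resolve_left (mul_ne_zero three_ne_zero hMC)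
      rw [trace_eq] at D0 D1 D2 D3 E0 E1 E2 E3 ⊢
      simp [Fin.sum_univ_four, eta4, raise_zero, raise_one, raise_two, raise_three,
        hsym 1 0, hsym 2 0, hsym 3 0, hsym 2 1, hsym 3 1, hsym 3 2]
        at D0 D1 D2 D3 E0 E1 E2 E3
      linear_combination E0 - E1 - E2 - E3
        - 2 * ((k 0 : ℂ) * D0 - (k 1 : ℂ) * D1 - (k 2 : ℂ) * D2 - (k 3 : ℂ) * D3)
    have div_zero : ∀ n : Fin 4, ∑ m : Fin 4, (raise k m : ℂ) * h m n = 0 := fun n => by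
      rw [div_eq, trace_zero, mul_zero]
    refine ⟨trace_zero, div_zero, fun m n => ?_⟩
    have Emn := E m n
    rw [trace_zero, div_zero, div_zero, sum_sum_mul_eq_zero div_zero] at Emn
    rw [Complex.ofReal_sub, Complex.ofReal_pow]
    linear_combination Emn
  · rintro ⟨trace_zero, div_zero, shell⟩ m n
    have hmn := shell m n
    rw [Complex.ofReal_sub, Complex.ofReal_pow] at hmn
    rw [trace_zero, div_zero, div_zero, sum_sum_mul_eq_zero div_zero]
    linear_combination hmn
end
end

section
/- Let k ∈ ℝ⁴, let m ∈ ℝ with m ≠ 0, and let Ψ : {0,1,2,3} → ℂ⁴ be a vector-spinor (a four-vector of Dirac spinors). Then the Rarita–Schwinger equation Σ_{r,n} γ^{[mrn]} k_r Ψ_n + m·Σ_n γ^{[mn]} Ψ_n = 0 holds for all m = 0,1,2,3 if and only if the three conditions hold: Σ_n γ^n Ψ_n = 0; Σ_n k^n Ψ_n = 0; and (Σ_r k_r γ^r − m·I₄)·Ψ_n = 0 for all n. -/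
noncomputable section

/-- The Pauli matrices `σ⁰ = I₂`, `σ¹`, `σ²`, `σ³`. -/
def pauli : Fin 4 → Matrix (Fin 2) (Fin 2) ℂ :=
  ![1, !![0, 1; 1, 0], !![0, -Complex.I; Complex.I, 0], !![1, 0; 0, -1]]

/-- The dual set `σ̃⁰ = σ⁰`, `σ̃ⁱ = −σⁱ` for `i = 1,2,3`. -/
def pauliT : Fin 4 → Matrix (Fin 2) (Fin 2) ℂ :=
  ![pauli 0, -pauli 1, -pauli 2, -pauli 3]

/-- The Dirac gamma matrices in the Weyl basis: `γⁿ = [[0, σⁿ],[σ̃ⁿ, 0]]`. -/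
def gam (n : Fin 4) : Matrix (Fin 4) (Fin 4) ℂ :=
  Matrix.reindex finSumFinEquiv finSumFinEquiv (Matrix.fromBlocks 0 (pauli n) (pauliT n) 0)

/-- The antisymmetrized product `γ^{[mn]} = ½(γᵐγⁿ − γⁿγᵐ)`. -/
def gam2 (m n : Fin 4) : Matrix (Fin 4) (Fin 4) ℂ :=
  (1 / 2 : ℂ) • (gam m * gam n - gam n * gam m)

/-- The antisymmetrized product `γ^{[mrn]} = (1/3)(γᵐ γ^{[rn]} − γʳ γ^{[mn]} + γⁿ γ^{[mr]})`. -/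
def gam3 (m r n : Fin 4) : Matrix (Fin 4) (Fin 4) ℂ :=
  (1 / 3 : ℂ) • (gam m * gam2 r n - gam r * gam2 m n + gam n * gam2 m r)

open Matrix

theorem pauli_mul_pauliT_add (m n : Fin 4) :
    pauli m * pauliT n + pauli n * pauliT m = (2 * eta4 m n : ℂ) • 1 := by
  fin_cases m <;> fin_cases n <;> ext i j <;> fin_cases i <;> fin_cases j <;>
    simp [pauli, pauliT, eta4] <;> norm_num

theorem pauliT_mul_pauli_add (m n : Fin 4) :
    pauliT m * pauli n + pauliT n * pauli m = (2 * eta4 m n : ℂ) • 1 := by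
  fin_cases m <;> fin_cases n <;> ext i j <;> fin_cases i <;> fin_cases j <;>
    simp [pauli, pauliT, eta4] <;> norm_num

theorem gam_mul_gam_add (m n : Fin 4) :
    gam m * gam n + gam n * gam m = (2 * eta4 m n : ℂ) • 1 := by
  simp only [gam, reindex_apply, submatrix_mul_equiv, fromBlocks_multiply, zero_mul, mul_zero,
    zero_add, add_zero]
  refine (congrFun₂ (submatrix_add _ _) _ _).symm.trans ?_
  have h : fromBlocks ((2 * eta4 m n : ℂ) • (1 : Matrix (Fin 2) (Fin 2) ℂ)) 0 0
      ((2 * eta4 m n : ℂ) • (1 : Matrix (Fin 2) (Fin 2) ℂ)) = (2 * eta4 m n : ℂ) • 1 := by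
    simp only [← fromBlocks_one, fromBlocks_smul, smul_zero]
  rw [fromBlocks_add, pauli_mul_pauliT_add, pauliT_mul_pauli_add, add_zero, h]
  exact congrArg (fun A : Matrix (Fin 4) (Fin 4) ℂ => (2 * eta4 m n : ℂ) • A)
    (submatrix_one_equiv (finSumFinEquiv (m := 2) (n := 2)).symm)

theorem gam_mul_gam_swap (m n : Fin 4) :
    gam m * gam n = (2 * eta4 m n : ℂ) • 1 - gam n * gam m :=
  eq_sub_of_add_eq (gam_mul_gam_add m n)

theorem eta4_comm (m n : Fin 4) : eta4 m n = eta4 n m := by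
  unfold eta4
  grind

theorem eta4_self_mul_self (m : Fin 4) : (eta4 m m : ℂ) * eta4 m m = 1 := by
  unfold eta4
  split_ifs <;> simp_all

theorem raise_apply (k : Fin 4 → ℝ) (n : Fin 4) : raise k n = eta4 n n * k n := by
  simp [raise, eta4]

theorem sum_eta4_smul {V : Type*} [AddCommGroup V] [Module ℂ V] (m : Fin 4) (v : Fin 4 → V) :
    ∑ n, (eta4 m n : ℂ) • v n = (eta4 m m : ℂ) • v m :=
  Finset.sum_eq_single m (fun n _ hn => by simp [eta4, hn.symm]) (by simp)

theorem gam2_eq (m n : Fin 4) : gam2 m n = gam m * gam n - (eta4 m n : ℂ) • 1 := by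
  rw [gam2, gam_mul_gam_swap n m, eta4_comm n m]
  module

theorem gam3_eq (m r n : Fin 4) :
    gam3 m r n = gam m * gam r * gam n - (eta4 m r : ℂ) • gam n - (eta4 r n : ℂ) • gam m
      + (eta4 m n : ℂ) • gam r := by
  have hr : gam r * (gam m * gam n) = (2 * eta4 m r : ℂ) • gam n - gam m * gam r * gam n := by
    rw [← mul_assoc, gam_mul_gam_swap r m, eta4_comm r m, sub_mul, smul_mul_assoc, one_mul]
  have hn : gam n * (gam m * gam r) = (2 * eta4 m n : ℂ) • gam r - (2 * eta4 r n : ℂ) • gam m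
      + gam m * gam r * gam n := by
    rw [← mul_assoc, gam_mul_gam_swap n m, eta4_comm n m, sub_mul, smul_mul_assoc, one_mul,
      mul_assoc (gam m), gam_mul_gam_swap n r, eta4_comm n r, mul_sub, mul_smul_comm, mul_one,
      ← mul_assoc]
    module
  simp only [gam3, gam2_eq, mul_sub, mul_smul_comm, mul_one, hr, hn, ← mul_assoc (gam m)]
  module

/-- The Feynman slash `k̸ = k_r γʳ`. -/
def slash (k : Fin 4 → ℝ) : Matrix (Fin 4) (Fin 4) ℂ :=
  ∑ r, (k r : ℂ) • gam r

/-- The gamma trace `γⁿ Ψ_n` of a vector-spinor. -/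
def gammaTrace (Ψ : Fin 4 → Fin 4 → ℂ) : Fin 4 → ℂ :=
  ∑ n, gam n *ᵥ Ψ n

/-- The divergence `kⁿ Ψ_n` of a vector-spinor. -/
def divergence (k : Fin 4 → ℝ) (Ψ : Fin 4 → Fin 4 → ℂ) : Fin 4 → ℂ :=
  ∑ n, (raise k n : ℂ) • Ψ n

theorem gam_mul_slash (k : Fin 4 → ℝ) (m : Fin 4) :
    gam m * slash k = (2 * raise k m : ℂ) • 1 - slash k * gam m := by
  have h : ∑ r, (k r : ℂ) • (2 * eta4 m r : ℂ) • (1 : Matrix (Fin 4) (Fin 4) ℂ)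
      = (2 * raise k m : ℂ) • 1 := by
    simp only [raise, smul_smul, ← Finset.sum_smul, Complex.ofReal_sum, Finset.mul_sum,
      Complex.ofReal_mul]
    congr 1
    exact Finset.sum_congr rfl fun _ _ => by ring
  simp only [slash, Finset.mul_sum, Finset.sum_mul, mul_smul_comm, smul_mul_assoc,
    gam_mul_gam_swap m, smul_sub, Finset.sum_sub_distrib, h]

theorem slash_mul_slash (k : Fin 4 → ℝ) :
    slash k * slash k = (∑ m, (k m * raise k m : ℂ)) • 1 := by
  have h : slash k * slash k = (2 * ∑ m, (k m * raise k m : ℂ)) • 1 - slash k * slash k := by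
    nth_rw 1 [slash]
    simp only [Finset.sum_mul, smul_mul_assoc, gam_mul_slash, smul_sub, Finset.sum_sub_distrib]
    congr 1
    · simp only [smul_smul, ← Finset.sum_smul, Finset.mul_sum]
      congr 1
      exact Finset.sum_congr rfl fun _ _ => by ring
    · nth_rw 3 [slash]
      simp only [Finset.mul_sum, mul_smul_comm]
  have h2 : (2 : ℂ) • (slash k * slash k) = (2 : ℂ) • (∑ m, (k m * raise k m : ℂ)) • 1 := by
    linear_combination (norm := module) h
  exact smul_right_injective _ (two_ne_zero' ℂ) h2

theorem gam_mul_self (m : Fin 4) : gam m * gam m = (eta4 m m : ℂ) • 1 := by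
  have h := gam_mul_gam_add m m
  have h2 : (2 : ℂ) • (gam m * gam m) = (2 : ℂ) • (eta4 m m : ℂ) • 1 := by
    linear_combination (norm := module) h
  exact smul_right_injective _ (two_ne_zero' ℂ) h2

/-- The left-hand side of the Rarita–Schwinger equation in terms of the slash operator, the gamma
trace and the divergence. -/
theorem rarita_schwinger_lhs_eq (k : Fin 4 → ℝ) (M : ℝ) (Ψ : Fin 4 → Fin 4 → ℂ) (m : Fin 4) :
    (∑ r, ∑ n, (k r : ℂ) • gam3 m r n *ᵥ Ψ n) + (M : ℂ) • ∑ n, gam2 m n *ᵥ Ψ n =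
      gam m *ᵥ slash k *ᵥ gammaTrace Ψ - (raise k m : ℂ) • gammaTrace Ψ
        - gam m *ᵥ divergence k Ψ + (eta4 m m : ℂ) • slash k *ᵥ Ψ m
        + (M : ℂ) • (gam m *ᵥ gammaTrace Ψ - (eta4 m m : ℂ) • Ψ m) := by
  have h2 : ∑ n, gam2 m n *ᵥ Ψ n = gam m *ᵥ gammaTrace Ψ - (eta4 m m : ℂ) • Ψ m := by
    simp only [gam2_eq, sub_mulVec, smul_mulVec, one_mulVec, ← mulVec_mulVec,
      Finset.sum_sub_distrib, sum_eta4_smul, gammaTrace, mulVec_sum]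
  have h3 (r : Fin 4) : ∑ n, (k r : ℂ) • gam3 m r n *ᵥ Ψ n =
      gam m *ᵥ ((k r : ℂ) • gam r) *ᵥ gammaTrace Ψ - ((eta4 m r * k r : ℝ) : ℂ) • gammaTrace Ψ
        - gam m *ᵥ ((raise k r : ℂ) • Ψ r) + (eta4 m m : ℂ) • ((k r : ℂ) • gam r) *ᵥ Ψ m := by
    simp only [gam3_eq, sub_mulVec, add_mulVec, smul_mulVec, ← mulVec_mulVec, smul_sub, smul_add,
      Finset.sum_sub_distrib, Finset.sum_add_distrib, ← Finset.smul_sum, ← mulVec_sum,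
      ← mulVec_smul, sum_eta4_smul, gammaTrace, raise_apply]
    simp only [mulVec_smul, ← Finset.smul_sum, Complex.ofReal_mul]
    module
  rw [h2]
  simp only [h3, Finset.sum_add_distrib, Finset.sum_sub_distrib, ← Finset.smul_sum,
    ← Finset.sum_smul, ← mulVec_sum, ← sum_mulVec, ← Complex.ofReal_sum]
  rfl

/-- Contracting the Rarita–Schwinger operator with the momentum. -/
theorem momentum_contraction (k : Fin 4 → ℝ) (M : ℝ) (Ψ : Fin 4 → Fin 4 → ℂ) :
    ∑ m, (k m : ℂ) • (gam m *ᵥ slash k *ᵥ gammaTrace Ψ - (raise k m : ℂ) • gammaTrace Ψ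
        - gam m *ᵥ divergence k Ψ + (eta4 m m : ℂ) • slash k *ᵥ Ψ m
        + (M : ℂ) • (gam m *ᵥ gammaTrace Ψ - (eta4 m m : ℂ) • Ψ m)) =
      (M : ℂ) • (slash k *ᵥ gammaTrace Ψ - divergence k Ψ) := by
  have hs (v : Fin 4 → ℂ) : ∑ m, (k m : ℂ) • gam m *ᵥ v = slash k *ᵥ v := by
    simp only [slash, sum_mulVec, smul_mulVec]
  have hd : ∑ m, (k m : ℂ) • (eta4 m m : ℂ) • Ψ m = divergence k Ψ :=
    Finset.sum_congr rfl fun m _ => by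
      rw [raise_apply, smul_smul, Complex.ofReal_mul, mul_comm]
  have hds : ∑ m, (k m : ℂ) • (eta4 m m : ℂ) • slash k *ᵥ Ψ m = slash k *ᵥ divergence k Ψ := by
    simp only [← hd, mulVec_sum, mulVec_smul]
  have hr : ∑ m, (k m : ℂ) • (raise k m : ℂ) • gammaTrace Ψ
      = slash k *ᵥ slash k *ᵥ gammaTrace Ψ := by
    rw [mulVec_mulVec, slash_mul_slash, smul_mulVec, one_mulVec, Finset.sum_smul]
    simp only [smul_smul]
  simp only [smul_add, smul_sub, smul_comm (k _ : ℂ) (M : ℂ), Finset.sum_add_distrib,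
    Finset.sum_sub_distrib, ← Finset.smul_sum, hs, hd, hds, hr]
  module

/-- Contracting the Rarita–Schwinger operator with the gamma matrices. -/
theorem gamma_contraction (k : Fin 4 → ℝ) (M : ℝ) (Ψ : Fin 4 → Fin 4 → ℂ) :
    ∑ m, (eta4 m m : ℂ) • gam m *ᵥ (gam m *ᵥ slash k *ᵥ gammaTrace Ψ
        - (raise k m : ℂ) • gammaTrace Ψ
        - gam m *ᵥ divergence k Ψ + (eta4 m m : ℂ) • slash k *ᵥ Ψ m
        + (M : ℂ) • (gam m *ᵥ gammaTrace Ψ - (eta4 m m : ℂ) • Ψ m)) =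
      (2 : ℂ) • (slash k *ᵥ gammaTrace Ψ - divergence k Ψ) + (3 * M : ℂ) • gammaTrace Ψ := by
  have hgg (m : Fin 4) (v : Fin 4 → ℂ) : (eta4 m m : ℂ) • gam m *ᵥ gam m *ᵥ v = v := by
    rw [mulVec_mulVec, gam_mul_self, smul_mulVec, one_mulVec, smul_smul, eta4_self_mul_self,
      one_smul]
  have hε (m : Fin 4) (v : Fin 4 → ℂ) : (eta4 m m : ℂ) • (eta4 m m : ℂ) • v = v := by
    rw [smul_smul, eta4_self_mul_self, one_smul]
  have hr (m : Fin 4) (v : Fin 4 → ℂ) :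
      (eta4 m m : ℂ) • (raise k m : ℂ) • v = (k m : ℂ) • v := by
    rw [raise_apply, Complex.ofReal_mul, mul_smul, hε]
  have hs : ∑ m, (k m : ℂ) • gam m *ᵥ gammaTrace Ψ = slash k *ᵥ gammaTrace Ψ := by
    simp only [slash, sum_mulVec, smul_mulVec]
  have hgs : ∑ m, gam m *ᵥ slash k *ᵥ Ψ m
      = (2 : ℂ) • divergence k Ψ - slash k *ᵥ gammaTrace Ψ := by
    simp only [mulVec_mulVec, gam_mul_slash, sub_mulVec, smul_mulVec, one_mulVec,
      Finset.sum_sub_distrib, divergence, gammaTrace, mulVec_sum, Finset.smul_sum, mul_smul]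
  have hg : ∑ m, gam m *ᵥ Ψ m = gammaTrace Ψ := rfl
  simp only [mulVec_add, mulVec_sub, mulVec_smul, smul_add, smul_sub,
    smul_comm (eta4 _ _ : ℂ) (M : ℂ), Finset.sum_add_distrib, Finset.sum_sub_distrib,
    ← Finset.smul_sum, hgg, hε, hr, hs, hgs, hg, Finset.sum_const, Finset.card_univ,
    Fintype.card_fin]
  module

/-- The Rarita–Schwinger equation `γ^{[mrn]} k_r Ψ_n + m γ^{[mn]} Ψ_n = 0` for a vector-spinor
`Ψ_n` is equivalent to `γⁿΨ_n = 0`, `kⁿΨ_n = 0` and the Dirac equation `(k_r γʳ − m)Ψ_n = 0`. -/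
theorem rarita_schwinger_equiv (k : Fin 4 → ℝ) (M : ℝ) (hM : M ≠ 0)
    (Ψ : Fin 4 → Fin 4 → ℂ) :
    (∀ m : Fin 4,
        (∑ r : Fin 4, ∑ n : Fin 4, (k r : ℂ) • (gam3 m r n).mulVec (Ψ n)) +
          (M : ℂ) • ∑ n : Fin 4, (gam2 m n).mulVec (Ψ n) = 0) ↔
      ((∑ n : Fin 4, (gam n).mulVec (Ψ n) = 0) ∧
        (∑ n : Fin 4, (raise k n : ℂ) • Ψ n = 0) ∧
        ∀ n : Fin 4,
          ((∑ r : Fin 4, (k r : ℂ) • gam r) - (M : ℂ) • (1 : Matrix (Fin 4) (Fin 4) ℂ)).mulVec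
            (Ψ n) = 0) := by
  simp only [rarita_schwinger_lhs_eq, sub_mulVec, smul_mulVec, one_mulVec]
  change _ ↔ gammaTrace Ψ = 0 ∧ divergence k Ψ = 0 ∧
    ∀ n, slash k *ᵥ Ψ n - (M : ℂ) • Ψ n = 0
  constructor
  · intro h
    have hM' : (M : ℂ) ≠ 0 := Complex.ofReal_ne_zero.mpr hM
    have hk := momentum_contraction k M Ψ
    have hg := gamma_contraction k M Ψ
    simp only [h, mulVec_zero, smul_zero, Finset.sum_const_zero] at hk hg
    have hd : slash k *ᵥ gammaTrace Ψ = divergence k Ψ :=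
      sub_eq_zero.mp ((smul_eq_zero.mp hk.symm).resolve_left hM')
    have ht : gammaTrace Ψ = 0 := by
      rw [hd, sub_self, smul_zero, zero_add] at hg
      exact (smul_eq_zero.mp hg.symm).resolve_left (mul_ne_zero three_ne_zero hM')
    have hd' : divergence k Ψ = 0 := by rw [← hd, ht, mulVec_zero]
    refine ⟨ht, hd', fun n => ?_⟩
    have hn := congrArg ((eta4 n n : ℂ) • ·) (h n)
    simp only [ht, hd', mulVec_zero, smul_zero, sub_zero, zero_sub, zero_add] at hn
    linear_combination (norm := module) hn - eta4_self_mul_self n • (slash k *ᵥ Ψ n - (M : ℂ) • Ψ n)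
  · rintro ⟨ht, hd, hD⟩ m
    rw [ht, hd, sub_eq_zero.mp (hD m)]
    simp only [mulVec_zero, smul_zero]
    module
end
end
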